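/- arXiv:math/9502226 — 2 statements merged into one kernel-verified Lean document; each statement's English description precedes it below -/
import Mathlib

section
/- A connected finite simple graph G is a minor-order obstruction for k-FES if and only if FES(G) = k + 1 and every edge of G lies in a triangle (equivalently, every edge contraction removes at least two edges, i.e., adjacent vertices always have a common neighbor). -/
open SimpleGraph

/-- `fes G` is the minimum number of edges whose removal from `G` leaves an acyclic graph. -/
noncomputable def fes {V : Type*} (G : SimpleGraph V) : ℕ :=
  sInf {k | ∃ s : Finset (Sym2 V), ↑s ⊆ G.edgeSet ∧ s.card = k ∧ (G.deleteEdges ↑s).IsAcyclic}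

/-- `H` is a minor of `G` (branch-set definition). -/
def IsMinor {W V : Type*} (H : SimpleGraph W) (G : SimpleGraph V) : Prop :=
  ∃ φ : W → Set V,
    (∀ w, (φ w).Nonempty) ∧
    (∀ w, (G.induce (φ w)).Connected) ∧
    (Pairwise fun w w' => Disjoint (φ w) (φ w')) ∧
    (∀ w w', H.Adj w w' → ∃ u ∈ φ w, ∃ v ∈ φ w', G.Adj u v)

/-- `H` is a proper minor of `G`. -/
def IsProperMinor {W V : Type*} (H : SimpleGraph W) (G : SimpleGraph V) : Prop :=
  IsMinor H G ∧ ¬ IsMinor G H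

lemma fes_le_of {V : Type*} {G : SimpleGraph V} (s : Finset (Sym2 V)) (hs : ↑s ⊆ G.edgeSet)
    (h : (G.deleteEdges ↑s).IsAcyclic) : fes G ≤ s.card :=
  Nat.sInf_le ⟨s, hs, rfl, h⟩

lemma fes_spec {V : Type*} [Finite V] (G : SimpleGraph V) :
    ∃ s : Finset (Sym2 V), ↑s ⊆ G.edgeSet ∧ s.card = fes G ∧
      (G.deleteEdges ↑s).IsAcyclic := by
  classical
  have : Fintype V := Fintype.ofFinite V
  have hne : {k | ∃ s : Finset (Sym2 V), ↑s ⊆ G.edgeSet ∧ s.card = k ∧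
      (G.deleteEdges ↑s).IsAcyclic}.Nonempty := by
    refine ⟨_, G.edgeFinset, by simp, rfl, ?_⟩
    have : G.deleteEdges ↑G.edgeFinset = ⊥ := by simp
    rw [this]
    exact isAcyclic_bot
  exact Nat.sInf_mem hne

lemma tree_card {V : Type*} [Finite V] {T : SimpleGraph V} (h : T.IsTree) :
    T.edgeSet.ncard + 1 = Nat.card V := by
  classical
  have : Fintype V := Fintype.ofFinite V
  have := h.card_edgeFinset
  rw [Nat.card_eq_fintype_card, ← this, ← Set.ncard_coe_finset, coe_edgeFinset]

lemma fes_formula {V : Type*} [Finite V] {G : SimpleGraph V} (hc : G.Connected) :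
    fes G + Nat.card V = G.edgeSet.ncard + 1 := by
  classical
  apply le_antisymm
  · obtain ⟨T, hle, hT⟩ := hc.exists_isTree_le
    have hfin : (G.edgeSet \ T.edgeSet).Finite := Set.toFinite _
    have h1 := fes_le_of (G := G) hfin.toFinset (by simp) (by
      refine hT.isAcyclic.anti ?_
      intro a b hab
      simp only [deleteEdges_adj] at hab
      by_contra hn
      exact hab.2 (by simpa using ⟨hab.1, hn⟩))
    rw [← Set.ncard_eq_toFinset_card _ hfin] at h1
    have h2 := Set.ncard_sdiff_add_ncard_of_subset (edgeSet_mono hle) (Set.toFinite _)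
    have := tree_card hT
    omega
  · obtain ⟨s, hs, hcard, hac⟩ := fes_spec G
    obtain ⟨F, hF1, hF2, hF⟩ := hc.exists_isTree_le_of_le_of_isAcyclic (deleteEdges_le _) hac
    have h1 : (G.edgeSet \ ↑s).ncard ≤ F.edgeSet.ncard := by
      apply Set.ncard_le_ncard _ (Set.toFinite _)
      rw [← edgeSet_deleteEdges]
      exact edgeSet_mono hF1
    have h2 := Set.ncard_sdiff_add_ncard_of_subset hs (Set.toFinite _)
    rw [Set.ncard_coe_finset] at h2
    have := tree_card hF
    omega

lemma fes_hom {V W : Type*} [Finite V] {H : SimpleGraph W} {G : SimpleGraph V}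
    (g : W → V) (hg : Function.Injective g) (hadj : ∀ a b, H.Adj a b → G.Adj (g a) (g b)) :
    fes H ≤ fes G := by
  classical
  obtain ⟨s, hs, hcard, hac⟩ := fes_spec G
  have : Finite W := Finite.of_injective g hg
  let t : Set (Sym2 W) := {e | e ∈ H.edgeSet ∧ Sym2.map g e ∈ s}
  have ht : t.Finite := Set.toFinite _
  have h1 := fes_le_of (G := H) ht.toFinset (by intro e he; simp [t] at he; exact he.1) (by
    refine IsAcyclic.comap ⟨g, ?_⟩ hg hac
    intro a b hab
    simp [t] at hab ⊢
    exact ⟨hadj _ _ hab.1, fun h => hab.2 hab.1 h⟩)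
  refine h1.trans (hcard ▸ ?_)
  apply Finset.card_le_card_of_injOn (Sym2.map g)
  · intro e he
    simp [t] at he
    exact he.2
  · exact (Sym2.map.injective hg).injOn

lemma minor_edges {V W : Type*} [Finite V] {H : SimpleGraph W} {G : SimpleGraph V}
    (h : IsMinor H G) : H.edgeSet.ncard ≤ G.edgeSet.ncard := by
  classical
  obtain ⟨φ, hne, -, hd, hadj⟩ := h
  rcases isEmpty_or_nonempty W with hW | ⟨⟨w0⟩⟩
  · have : H.edgeSet = ∅ := by
      ext e
      induction e with | _ a b => exact hW.elim a
    simp [this]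
  · let g : V → W := fun x => if h : ∃ w, x ∈ φ w then h.choose else w0
    have hg : ∀ x w, x ∈ φ w → g x = w := by
      intro x w hx
      have hex : ∃ w, x ∈ φ w := ⟨w, hx⟩
      have : g x = hex.choose := dif_pos hex
      rw [this]
      by_contra hn
      exact Set.disjoint_left.1 (hd hn) hex.choose_spec hx
    have hsub : H.edgeSet ⊆ Sym2.map g '' G.edgeSet := by
      intro e
      induction e with | _ a b =>
      intro hab
      obtain ⟨u, hu, v, hv, huv⟩ := hadj a b hab
      exact ⟨s(u, v), huv, by simp [hg u a hu, hg v b hv]⟩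
    exact (Set.ncard_le_ncard hsub (Set.toFinite _)).trans (Set.ncard_image_le (Set.toFinite _))

lemma reach_map {V W : Type*} {G : SimpleGraph V} {G' : SimpleGraph W} (f : V → W)
    (h : ∀ x y, G.Adj x y → G'.Reachable (f x) (f y)) {x y : V} (hr : G.Reachable x y) :
    G'.Reachable (f x) (f y) := by
  obtain ⟨p⟩ := hr
  induction p with
  | nil => exact Reachable.refl _
  | cons hadj _ ih => exact (h _ _ hadj).trans ih

/-- `f` is surjective and identifies exactly `u` and `v`. -/
def Contr {V W : Type*} (f : V → W) (u v : V) : Prop :=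
  Function.Surjective f ∧
    ∀ x y, f x = f y ↔ x = y ∨ (x = u ∧ y = v) ∨ (x = v ∧ y = u)

lemma exists_contr {V : Type*} (u v : V) (huv : u ≠ v) :
    ∃ f : V → {x // x ≠ v}, Contr f u v := by
  classical
  refine ⟨fun x => if h : x = v then ⟨u, huv⟩ else ⟨x, h⟩, ?_, ?_⟩
  · rintro ⟨x, hx⟩
    exact ⟨x, by simp [hx]⟩
  · intro x y
    by_cases hx : x = v <;> by_cases hy : y = v <;> simp [hx, hy] <;> grind

section
variable {V W : Type*} {G : SimpleGraph V} {f : V → W} {u v : V}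

lemma map_reach (f : V → W) (G : SimpleGraph V) (x y : V) (h : G.Adj x y) :
    (G.map f).Reachable (f x) (f y) := by
  by_cases hxy : f x = f y
  · rw [hxy]
  · exact Adj.reachable ⟨hxy, x, y, h, rfl, rfl⟩

lemma contr_connected (hf : Contr f u v) (hc : G.Connected) : (G.map f).Connected := by
  have : Nonempty W := hc.nonempty.map f
  refine ⟨?_⟩
  intro a b
  obtain ⟨x, rfl⟩ := hf.1 a
  obtain ⟨y, rfl⟩ := hf.1 b
  exact reach_map f (map_reach f G) (hc.preconnected x y)

lemma contr_edges_le [Finite V] (hf : Contr f u v) (huv : G.Adj u v) :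
    (G.map f).edgeSet.ncard + 1 ≤ G.edgeSet.ncard := by
  have hsub : (G.map f).edgeSet ⊆ Sym2.map f '' (G.edgeSet \ {s(u, v)}) := by
    intro e
    induction e with | _ a b =>
    rintro ⟨hne, x, y, hxy, rfl, rfl⟩
    refine ⟨s(x, y), ⟨hxy, ?_⟩, rfl⟩
    intro h
    apply hne
    rw [hf.2]
    simp at h
    tauto
  have h1 := (Set.ncard_le_ncard hsub (Set.toFinite _)).trans
    (Set.ncard_image_le (Set.toFinite _))
  have h2 := Set.ncard_sdiff_singleton_add_one (s := G.edgeSet) (a := s(u, v)) huv (Set.toFinite _)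
  omega

lemma contr_edges_le2 [Finite V] (hf : Contr f u v) (huv : G.Adj u v) {w : V}
    (huw : G.Adj u w) (hvw : G.Adj v w) :
    (G.map f).edgeSet.ncard + 2 ≤ G.edgeSet.ncard := by
  have hsub : (G.map f).edgeSet ⊆ Sym2.map f '' ((G.edgeSet \ {s(u, v)}) \ {s(v, w)}) := by
    intro e
    induction e with | _ a b =>
    rintro ⟨hne, x, y, hxy, rfl, rfl⟩
    have hfuv : f u = f v := (hf.2 u v).2 (by tauto)
    by_cases hq : s(x, y) = s(v, w)
    · refine ⟨s(u, w), ⟨⟨huw, ?_⟩, ?_⟩, ?_⟩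
      · simp only [Set.mem_singleton_iff, Sym2.eq_iff]
        have := hvw.ne
        have := huw.ne
        grind
      · simp only [Set.mem_singleton_iff, Sym2.eq_iff]
        have := huv.ne
        have := huw.ne
        grind
      · have : Sym2.map f s(x, y) = Sym2.map f s(v, w) := by rw [hq]
        simp only [Sym2.map_mk] at this ⊢
        rw [hfuv]
        exact this.symm
    · refine ⟨s(x, y), ⟨⟨hxy, ?_⟩, hq⟩, rfl⟩
      intro h
      apply hne
      rw [hf.2]
      simp at h
      tauto
  have h1 := (Set.ncard_le_ncard hsub (Set.toFinite _)).trans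
    (Set.ncard_image_le (Set.toFinite _))
  have h2 := Set.ncard_sdiff_singleton_add_one (s := G.edgeSet) (a := s(u, v)) huv (Set.toFinite _)
  have h3 := Set.ncard_sdiff_singleton_add_one (s := G.edgeSet \ {s(u, v)}) (a := s(v, w))
    ⟨hvw, by
      simp only [Set.mem_singleton_iff, Sym2.eq_iff]
      have := hvw.ne
      have := huw.ne
      grind⟩ (Set.toFinite _)
  omega

lemma contr_edges_ge [Finite V] (hf : Contr f u v) (huv : G.Adj u v)
    (hno : ¬ ∃ w, G.Adj u w ∧ G.Adj v w) :
    G.edgeSet.ncard ≤ (G.map f).edgeSet.ncard + 1 := by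
  have : Finite W := Finite.of_surjective f hf.1
  have h2 := Set.ncard_sdiff_singleton_add_one (s := G.edgeSet) (a := s(u, v)) huv (Set.toFinite _)
  have h1 : (G.edgeSet \ {s(u, v)}).ncard ≤ (G.map f).edgeSet.ncard := by
    apply Set.ncard_le_ncard_of_injOn (Sym2.map f) _ _ (Set.toFinite _)
    · intro e
      induction e with | _ x y =>
      rintro ⟨hxy, hne⟩
      refine ⟨?_, x, y, hxy, rfl, rfl⟩
      intro h
      replace h : f x = f y := h
      rw [hf.2] at h
      have hxy' : x ≠ y := Adj.ne hxy
      apply hne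
      simp only [Set.mem_singleton_iff, Sym2.eq_iff]
      tauto
    · intro e
      induction e with | _ x y =>
      rintro ⟨hxy, hne⟩ e'
      induction e' with | _ x' y' =>
      rintro ⟨hxy', hne'⟩ heq
      simp only [Set.mem_singleton_iff, Sym2.eq_iff, mem_edgeSet, Sym2.map_mk, hf.2] at *
      have := G.symm
      have h1 := hxy.symm
      have h2 := hxy'.symm
      have h3 := hxy.ne
      have h4 := hxy'.ne
      push Not at hno
      grind
  omega

lemma contr_card [Finite V] (hf : Contr f u v) (huv : u ≠ v) :
    Nat.card W + 1 = Nat.card V := by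
  have hb : Function.Bijective (fun x : {x // x ≠ v} => f x) := by
    constructor
    · rintro ⟨x, hx⟩ ⟨y, hy⟩ h
      simp only [hf.2] at h
      ext
      grind
    · intro b
      obtain ⟨x, rfl⟩ := hf.1 b
      by_cases hx : x = v
      · exact ⟨⟨u, huv⟩, (hf.2 _ _).2 (by grind)⟩
      · exact ⟨⟨x, hx⟩, rfl⟩
  rw [← Nat.card_eq_of_bijective _ hb]
  have := Set.ncard_add_ncard_compl ({v} : Set V)
  have h2 : ({v}ᶜ : Set V).ncard = Nat.card {x // x ≠ v} := rfl
  simp at this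
  omega

lemma contr_isMinor (hf : Contr f u v) (huv : G.Adj u v) : IsMinor (G.map f) G := by
  refine ⟨fun a => f ⁻¹' {a}, ?_, ?_, ?_, ?_⟩
  · intro a
    obtain ⟨x, rfl⟩ := hf.1 a
    exact ⟨x, rfl⟩
  · intro a
    obtain ⟨x, rfl⟩ := hf.1 a
    have : Nonempty (f ⁻¹' {f x}) := ⟨⟨x, rfl⟩⟩
    refine ⟨?_⟩
    rintro ⟨y, hy⟩ ⟨z, hz⟩
    have hyz : f y = f z := by
      simp at hy hz
      rw [hy, hz]
    rw [hf.2] at hyz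
    rcases hyz with rfl | ⟨rfl, rfl⟩ | ⟨rfl, rfl⟩
    · rfl
    · exact Adj.reachable huv
    · exact Adj.reachable huv.symm
  · intro a b hab
    rw [Set.disjoint_left]
    rintro x rfl hx
    exact hab hx
  · rintro a b ⟨hne, x, y, hxy, rfl, rfl⟩
    exact ⟨x, rfl, y, rfl, hxy⟩

end

lemma minor_contr {V W X : Type*} {G : SimpleGraph V} {f : V → W} {u v : V} (hf : Contr f u v)
    {H : SimpleGraph X} {φ : X → Set V}
    (h1 : ∀ w, (φ w).Nonempty) (h2 : ∀ w, (G.induce (φ w)).Connected)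
    (h3 : Pairwise fun w w' => Disjoint (φ w) (φ w'))
    (h4 : ∀ w w', H.Adj w w' → ∃ u ∈ φ w, ∃ v ∈ φ w', G.Adj u v)
    {w0 : X} (hu : u ∈ φ w0) (hv : v ∈ φ w0) : IsMinor H (G.map f) := by
  have key : ∀ w w' x y, x ∈ φ w → y ∈ φ w' → f x = f y → w = w' := by
    intro w w' x y hx hy hxy
    have huniq : ∀ a b z, z ∈ φ a → z ∈ φ b → a = b := by
      intro a b z ha hb
      by_contra hn
      exact Set.disjoint_left.1 (h3 hn) ha hb
    rw [hf.2] at hxy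
    rcases hxy with rfl | ⟨rfl, rfl⟩ | ⟨rfl, rfl⟩
    · exact huniq _ _ _ hx hy
    · exact (huniq _ _ _ hx hu).trans (huniq _ _ _ hv hy)
    · exact (huniq _ _ _ hx hv).trans (huniq _ _ _ hu hy)
  refine ⟨fun w => f '' φ w, fun w => (h1 w).image f, ?_, ?_, ?_⟩
  · intro w
    have : Nonempty (f '' φ w) := ((h1 w).image f).to_subtype
    refine ⟨?_⟩
    rintro ⟨_, x, hx, rfl⟩ ⟨_, y, hy, rfl⟩
    refine reach_map (G := G.induce (φ w)) (G' := (G.map f).induce (f '' φ w))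
      (fun z => ⟨f z, z, z.2, rfl⟩) ?_ ((h2 w).preconnected ⟨x, hx⟩ ⟨y, hy⟩)
    rintro ⟨a, ha⟩ ⟨b, hb⟩ hab
    by_cases hfab : f a = f b
    · simp only [hfab]
      rfl
    · exact Adj.reachable ⟨hfab, a, b, hab, rfl, rfl⟩
  · intro w w' hne
    rw [Set.disjoint_left]
    rintro _ ⟨x, hx, rfl⟩ ⟨y, hy, hxy⟩
    exact hne (key _ _ _ _ hx hy hxy.symm)
  · intro w w' hww
    obtain ⟨x, hx, y, hy, hxy⟩ := h4 w w' hww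
    exact ⟨f x, ⟨x, hx, rfl⟩, f y, ⟨y, hy, rfl⟩,
      fun h => hww.ne (key _ _ _ _ hx hy h), x, y, hxy, rfl, rfl⟩

/-- Either all branch sets are singletons or some branch set contains an edge. -/
lemma minor_cases {V X : Type*} {G : SimpleGraph V}
    {H : SimpleGraph X} {φ : X → Set V}
    (h1 : ∀ w, (φ w).Nonempty) (h2 : ∀ w, (G.induce (φ w)).Connected)
    (h3 : Pairwise fun w w' => Disjoint (φ w) (φ w'))
    (h4 : ∀ w w', H.Adj w w' → ∃ u ∈ φ w, ∃ v ∈ φ w', G.Adj u v) :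
    (∃ w u v, u ∈ φ w ∧ v ∈ φ w ∧ G.Adj u v) ∨
    (∃ g : X → V, Function.Injective g ∧ ∀ a b, H.Adj a b → G.Adj (g a) (g b)) := by
  by_cases hs : ∀ w, (φ w).Subsingleton
  · right
    choose g hg using h1
    refine ⟨g, ?_, ?_⟩
    · intro a b hab
      by_contra hn
      exact Set.disjoint_left.1 (h3 hn) (hg a) (hab ▸ hg b)
    · intro a b hab
      obtain ⟨x, hx, y, hy, hxy⟩ := h4 a b hab
      rwa [hs a (hg a) hx, hs b (hg b) hy]
  · left
    obtain ⟨w, hw⟩ := not_forall.1 hs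
    have : Nontrivial (φ w) := (show (φ w).Nontrivial by
      simpa [Set.not_subsingleton_iff] using hw).coe_sort
    obtain ⟨x, hx⟩ := h1 w
    obtain ⟨y, hy⟩ := (h2 w).preconnected.exists_adj_of_nontrivial ⟨x, hx⟩
    exact ⟨w, x, y, hx, y.2, hy⟩

universe u₁ u₂

lemma fes_minor (n : ℕ) : ∀ {V : Type u₁} {X : Type u₂} [Finite V] {G : SimpleGraph V}
    {H : SimpleGraph X}, Nat.card V = n → G.Connected → IsMinor H G → fes H ≤ fes G := by
  induction n with
  | zero =>
    intro V X _ G H hn hc _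
    have := hc.nonempty
    have := Nat.card_pos (α := V)
    omega
  | succ n ih =>
    intro V X _ G H hn hc hm
    obtain ⟨φ, h1, h2, h3, h4⟩ := hm
    rcases minor_cases h1 h2 h3 h4 with ⟨w, u, v, hu, hv, huv⟩ | ⟨g, hg, hadj⟩
    · obtain ⟨f, hf⟩ := exists_contr u v huv.ne
      have hcard := contr_card hf huv.ne
      have hc' := contr_connected hf hc
      have := ih (by omega) hc' (minor_contr hf h1 h2 h3 h4 hu hv)
      have e1 := fes_formula hc
      have e2 := fes_formula hc'
      have e3 := contr_edges_le hf huv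
      omega
    · exact fes_hom g hg hadj

lemma minor_of_le {V X : Type*} {G : SimpleGraph V} {H : SimpleGraph X} (g : X → V)
    (hg : Function.Injective g) (h : ∀ a b, H.Adj a b → G.Adj (g a) (g b)) : IsMinor H G := by
  refine ⟨fun x => {g x}, fun _ => Set.singleton_nonempty _, ?_, ?_, ?_⟩
  · intro w
    have : Nonempty ({g w} : Set V) := ⟨⟨_, rfl⟩⟩
    refine ⟨?_⟩
    rintro ⟨_, rfl⟩ ⟨_, rfl⟩
    rfl
  · intro a b hab
    simpa using fun h => hab (hg h)
  · intro a b hab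
    exact ⟨_, rfl, _, rfl, h a b hab⟩


/-- A connected finite simple graph `G` is a minor-order obstruction for `k`-FES iff
`FES(G) = k + 1` and every pair of adjacent vertices of `G` has a common neighbor
(every edge lies in a triangle). -/
theorem stmt13 {V : Type*} [Fintype V] (G : SimpleGraph V) (k : ℕ)
    (hconn : G.Connected) :
    (¬ fes G ≤ k ∧
      ∀ (W : Type) [Fintype W] (H : SimpleGraph W), IsProperMinor H G → fes H ≤ k) ↔
    (fes G = k + 1 ∧ ∀ u v, G.Adj u v → ∃ w, G.Adj u w ∧ G.Adj v w) := by
  classical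
  constructor
  · rintro ⟨hk, hob⟩
    let e : V ≃ Fin (Fintype.card V) := Fintype.equivFin V
    constructor
    · have hex : ∃ u v, G.Adj u v := by
        by_contra hno
        push Not at hno
        have hbot : G = ⊥ := by
          ext a b
          simp [hno a b]
        have h0 := fes_le_of (G := G) ∅ (by simp) (by
          rw [hbot]
          exact isAcyclic_bot.anti (deleteEdges_le _))
        simp at h0
        omega
      obtain ⟨u, v, huv⟩ := hex
      let H : SimpleGraph (Fin (Fintype.card V)) := (G.deleteEdges {s(u, v)}).comap e.symm
      have hm : IsMinor H G := minor_of_le e.symm e.symm.injective (by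
        intro a b hab
        exact (deleteEdges_le _) hab)
      have hnm : ¬ IsMinor G H := by
        intro hm'
        have a1 := minor_edges hm'
        have a2 : H.edgeSet.ncard ≤ (G.deleteEdges {s(u, v)}).edgeSet.ncard :=
          minor_edges (minor_of_le e.symm e.symm.injective (fun a b h => h))
        rw [edgeSet_deleteEdges] at a2
        have a3 := Set.ncard_sdiff_singleton_add_one (s := G.edgeSet) (a := s(u, v)) huv
          (Set.toFinite _)
        omega
      have b1 := hob _ H ⟨hm, hnm⟩
      have b2 : fes (G.deleteEdges {s(u, v)}) ≤ fes H := fes_hom e e.injective (by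
        intro a b hab
        simpa [H] using hab)
      obtain ⟨s, hs, hcard, hac⟩ := fes_spec (G.deleteEdges {s(u, v)})
      have b3 := fes_le_of (G := G) (insert s(u, v) s) (by
          intro x hx
          simp only [Finset.coe_insert, Set.mem_insert_iff] at hx
          rcases hx with rfl | hx
          · exact huv
          · exact edgeSet_mono (deleteEdges_le _) (hs hx)) (by
          rw [deleteEdges_deleteEdges] at hac
          rwa [Finset.coe_insert, Set.insert_eq])
      have b4 := Finset.card_insert_le s(u, v) s
      omega
    · intro u v huv
      by_contra hno
      obtain ⟨f0, hf0⟩ := exists_contr u v huv.ne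
      let e' := Fintype.equivFin {x // x ≠ v}
      have hf : Contr (fun x => e' (f0 x)) u v :=
        ⟨e'.surjective.comp hf0.1, fun x y => by simp [hf0.2]⟩
      have c1 := contr_edges_le hf huv
      have c2 := contr_edges_ge hf huv hno
      have c3 := contr_card hf huv.ne
      have c4 := fes_formula hconn
      have c5 := fes_formula (contr_connected hf hconn)
      have c6 := hob _ (G.map (fun x => e' (f0 x))) ⟨contr_isMinor hf huv, fun hm => by
        have := minor_edges hm
        omega⟩
      omega
  · rintro ⟨hk, htri⟩
    refine ⟨by omega, ?_⟩
    intro W _ H ⟨hm, hnm⟩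
    obtain ⟨φ, h1, h2, h3, h4⟩ := hm
    have e1 := fes_formula hconn
    rcases minor_cases h1 h2 h3 h4 with ⟨w, u, v, hu, hv, huv⟩ | ⟨g, hg, hadj⟩
    · obtain ⟨f, hf⟩ := exists_contr u v huv.ne
      have hcard := contr_card hf huv.ne
      have hc' := contr_connected hf hconn
      have := fes_minor _ rfl hc' (minor_contr hf h1 h2 h3 h4 hu hv)
      have e2 := fes_formula hc'
      obtain ⟨z, huz, hvz⟩ := htri u v huv
      have e3 := contr_edges_le2 hf huv huz hvz
      omega
    · by_cases hall : ∀ x y, G.Adj x y → ∃ a b, H.Adj a b ∧ g a = x ∧ g b = y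
      · exfalso
        apply hnm
        have hnt : Nontrivial V := by
          by_contra hn
          rw [not_nontrivial_iff_subsingleton] at hn
          have h0 := fes_le_of (G := G) ∅ (by simp) IsAcyclic.of_subsingleton
          simp at h0
          omega
        have hsurj : Function.Surjective g := by
          intro x
          obtain ⟨y, hy⟩ := hconn.preconnected.exists_adj_of_nontrivial x
          obtain ⟨a, b, -, ha, -⟩ := hall x y hy
          exact ⟨a, ha⟩
        let E := Equiv.ofBijective g ⟨hg, hsurj⟩
        refine minor_of_le E.symm E.symm.injective ?_
        intro x y hxy
        obtain ⟨a, b, hab, rfl, rfl⟩ := hall x y hxy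
        have h : ∀ a, E.symm (g a) = a := fun a => E.symm_apply_apply a
        rwa [h, h]
      · push Not at hall
        obtain ⟨u, v, huv, hno⟩ := hall
        have hle : fes H ≤ fes (G.deleteEdges {s(u, v)}) := fes_hom g hg (by
          intro a b hab
          simp only [deleteEdges_adj, Set.mem_singleton_iff, Sym2.eq_iff]
          refine ⟨hadj a b hab, ?_⟩
          rintro (⟨ha, hb⟩ | ⟨ha, hb⟩)
          · exact hno a b hab ha hb
          · exact hno b a hab.symm hb ha)
        obtain ⟨z, huz, hvz⟩ := htri u v huv
        have hre : (G.deleteEdges {s(u, v)}).Reachable u v := by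
          have r1 : (G.deleteEdges {s(u, v)}).Adj u z := by
            simp only [deleteEdges_adj, Set.mem_singleton_iff, Sym2.eq_iff]
            have := huz.ne
            have := hvz.ne
            grind
          have r2 : (G.deleteEdges {s(u, v)}).Adj v z := by
            simp only [deleteEdges_adj, Set.mem_singleton_iff, Sym2.eq_iff]
            have := huz.ne
            have := hvz.ne
            grind
          exact r1.reachable.trans r2.reachable.symm
        have hc' : (G.deleteEdges {s(u, v)}).Connected := by
          have := hconn.nonempty
          refine ⟨?_⟩
          intro a b
          refine reach_map id ?_ (hconn.preconnected a b)
          intro x y hxy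
          by_cases hq : s(x, y) = s(u, v)
          · rw [Sym2.eq_iff] at hq
            rcases hq with ⟨rfl, rfl⟩ | ⟨rfl, rfl⟩
            · exact hre
            · exact hre.symm
          · exact Adj.reachable (by simpa [deleteEdges_adj] using ⟨hxy, by simpa using hq⟩)
        have e2 := fes_formula hc'
        rw [edgeSet_deleteEdges] at e2
        have a3 := Set.ncard_sdiff_singleton_add_one (s := G.edgeSet) (a := s(u, v)) huv
          (Set.toFinite _)
        omega
end

section
/- If G is a connected graph that is a minor-order obstruction for k-FES, then the graph obtained from G by attaching a triangle K_3 at a single vertex of G (identifying one vertex of a new triangle with a vertex of G) is a connected obstruction for (k+1)-FES. -/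
open SimpleGraph

/-- The graph obtained from `G` by attaching a new triangle at the vertex `v`:
two new vertices `inr 0`, `inr 1` forming a triangle with `v`. -/
def attachTriangle {V : Type*} (G : SimpleGraph V) (v : V) :
    SimpleGraph (V ⊕ Fin 2) :=
  SimpleGraph.fromRel (fun x y =>
    (∃ a b, x = Sum.inl a ∧ y = Sum.inl b ∧ G.Adj a b) ∨
    (x = Sum.inl v ∧ ∃ i, y = Sum.inr i) ∨
    (x = Sum.inr 0 ∧ y = Sum.inr 1))


section aux

theorem aux_fes_le {W : Type*} [Finite W] (H : SimpleGraph W) (n : ℕ) :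
    fes H ≤ n ↔ ∃ s : Set (Sym2 W), s.ncard ≤ n ∧ (H.deleteEdges s).IsAcyclic := by
  classical
  have := Fintype.ofFinite W
  constructor
  · intro h
    have hne : {k | ∃ s : Finset (Sym2 W), ↑s ⊆ H.edgeSet ∧ s.card = k ∧
        (H.deleteEdges ↑s).IsAcyclic}.Nonempty := by
      refine ⟨_, H.edgeFinset, by simp, rfl, ?_⟩
      have : H.deleteEdges (↑H.edgeFinset) = ⊥ := by ext a b; simp
      rw [this]
      exact isAcyclic_bot
    obtain ⟨s, -, hc, ha⟩ := Nat.sInf_mem hne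
    refine ⟨↑s, ?_, ha⟩
    rw [Set.ncard_coe_finset, hc]
    exact h
  · rintro ⟨s, hs, ha⟩
    have h1 : (H.deleteEdges (↑(s.toFinset ∩ H.edgeFinset) : Set (Sym2 W))) = H.deleteEdges s := by
      ext a b
      simp only [deleteEdges_adj, Finset.coe_inter, Set.coe_toFinset, coe_edgeFinset,
        Set.mem_inter_iff, mem_edgeSet]
      tauto
    refine le_trans (Nat.sInf_le ⟨s.toFinset ∩ H.edgeFinset, by simp, rfl, ?_⟩) ?_
    · rw [h1]; exact ha
    · refine le_trans (Finset.card_le_card Finset.inter_subset_left) ?_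
      rwa [← Set.ncard_eq_toFinset_card']

theorem aux_edges {W V : Type*} [Finite V] {H : SimpleGraph W} {G : SimpleGraph V}
    (h : IsMinor H G) : H.edgeSet.ncard ≤ G.edgeSet.ncard := by
  obtain ⟨φ, hne, hc, hd, he⟩ := h
  have key : ∀ e ∈ H.edgeSet, ∃ e' ∈ G.edgeSet, ∃ w w' u v, e = s(w, w') ∧ e' = s(u, v) ∧
      u ∈ φ w ∧ v ∈ φ w' := by
    intro e hm
    induction e using Sym2.ind with
    | _ w w' =>
      obtain ⟨u, hu, v, hv, ha⟩ := he w w' hm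
      exact ⟨s(u, v), ha, w, w', u, v, rfl, rfl, hu, hv⟩
  have hu : ∀ x a b, x ∈ φ a → x ∈ φ b → a = b := by
    intro x a b ha hb
    by_contra hab
    exact Set.disjoint_left.1 (hd hab) ha hb
  rcases H.edgeSet.eq_empty_or_nonempty with h0 | ⟨e0, h0⟩
  · simp [h0]
  have : Nonempty (Sym2 V) := ⟨(key e0 h0).choose⟩
  choose! f hf hf2 using key
  refine Set.ncard_le_ncard_of_injOn f hf ?_ (Set.toFinite _)
  intro e1 h1 e2 h2 heq
  obtain ⟨a, b, u, v, e1e, fe1, hua, hvb⟩ := hf2 e1 h1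
  obtain ⟨a', b', u', v', e2e, fe2, hua', hvb'⟩ := hf2 e2 h2
  rw [fe1, fe2] at heq
  rw [e1e, e2e]
  rcases Sym2.eq_iff.1 heq with ⟨rfl, rfl⟩ | ⟨rfl, rfl⟩
  · rw [hu _ _ _ hua hua', hu _ _ _ hvb hvb']
  · rw [hu _ _ _ hua hvb', hu _ _ _ hvb hua', Sym2.eq_swap]

theorem aux_acyclic {W : Type*} (K : SimpleGraph W) (A : Set W)
    (h1 : (K.induce A).IsAcyclic)
    (h2 : ∀ S : Set W, (∀ x ∈ S, ∃ y ∈ S, ∃ z ∈ S, y ≠ z ∧ K.Adj x y ∧ K.Adj x z) → S ⊆ A) :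
    K.IsAcyclic := by
  classical
  intro a c hc
  have hS : {x | x ∈ c.support} ⊆ A := by
    apply h2
    intro x hx
    have hr := hc.rotate hx
    have hsub : ∀ y, y ∈ (c.rotate x hx).support → y ∈ c.support := by
      intro y hy
      simpa using hy
    refine ⟨_, hsub _ (Walk.getVert_mem_support _ 1), _, hsub _ (Walk.getVert_mem_support _ _),
      hr.snd_ne_penultimate, Walk.adj_snd hr.not_nil, (Walk.adj_penultimate hr.not_nil).symm⟩
  have : (c.induce A (fun x hx => hS hx)).IsCycle := by
    apply Walk.IsCycle.of_map (f := (Embedding.induce A).toHom)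
    rw [Walk.map_induce]
    exact hc
  exact h1 _ this

theorem aux_reach {A B : Type*} {G : SimpleGraph A} {H : SimpleGraph B} (f : A → B)
    (hf : ∀ x y, G.Adj x y → H.Reachable (f x) (f y)) {x y : A} (h : G.Reachable x y) :
    H.Reachable (f x) (f y) := by
  obtain ⟨p⟩ := h
  induction p with
  | nil => exact Reachable.refl _
  | cons hadj _ ih => exact (hf _ _ hadj).trans ih

theorem aux_ll {V : Type*} {G : SimpleGraph V} {v a b : V} :
    (attachTriangle G v).Adj (Sum.inl a) (Sum.inl b) ↔ G.Adj a b := by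
  simp only [attachTriangle, fromRel_adj]
  constructor
  · rintro ⟨-, h | h⟩ <;> simp at h
    · exact h
    · exact h.symm
  · intro h
    exact ⟨by simpa using h.ne, by simp [h]⟩

theorem aux_lr {V : Type*} {G : SimpleGraph V} {v a : V} {i : Fin 2} :
    (attachTriangle G v).Adj (Sum.inl a) (Sum.inr i) ↔ a = v := by
  simp [attachTriangle, fromRel_adj]
  omega

theorem aux_rl {V : Type*} {G : SimpleGraph V} {v a : V} {i : Fin 2} :
    (attachTriangle G v).Adj (Sum.inr i) (Sum.inl a) ↔ a = v := by
  rw [adj_comm, aux_lr]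

theorem aux_rr {V : Type*} {G : SimpleGraph V} {v : V} {i j : Fin 2} :
    (attachTriangle G v).Adj (Sum.inr i) (Sum.inr j) ↔ i ≠ j := by
  simp [attachTriangle, fromRel_adj]
  omega

theorem aux_conn {V : Type*} {G : SimpleGraph V} {v : V} (h : G.Connected) :
    (attachTriangle G v).Connected := by
  rw [connected_iff_exists_forall_reachable]
  refine ⟨Sum.inl v, ?_⟩
  rintro (a | i)
  · exact aux_reach (G := G) Sum.inl (fun x y hxy => (aux_ll.2 hxy).reachable) (h.preconnected v a)
  · exact (aux_lr.2 rfl).reachable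

theorem aux_low {V : Type*} [Finite V] {G : SimpleGraph V} {v : V} {k : ℕ}
    (h : fes (attachTriangle G v) ≤ k + 1) : fes G ≤ k := by
  rw [aux_fes_le] at h ⊢
  obtain ⟨s, hs, ha⟩ := h
  have hinj : Function.Injective (Sym2.map (Sum.inl : V → V ⊕ Fin 2)) :=
    Sym2.map.injective Sum.inl_injective
  refine ⟨(Sym2.map Sum.inl) ⁻¹' s, ?_, ?_⟩
  · have hex : ∃ e ∈ s, e ∉ Set.range (Sym2.map (Sum.inl : V → V ⊕ Fin 2)) := by
      by_contra hcon
      push Not at hcon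
      have hno : ∀ x (i : Fin 2), s(x, Sum.inr i) ∉ s := by
        intro x i hx
        obtain ⟨e, he⟩ := hcon _ hx
        have : (Sum.inr i : V ⊕ Fin 2) ∈ Sym2.map (Sum.inl : V → V ⊕ Fin 2) e := by
          rw [he]; simp
        simp at this
      have a1 : ((attachTriangle G v).deleteEdges s).Adj (Sum.inl v) (Sum.inr 0) :=
        deleteEdges_adj.2 ⟨aux_lr.2 rfl, hno _ _⟩
      have a2 : ((attachTriangle G v).deleteEdges s).Adj (Sum.inr 0) (Sum.inr 1) :=
        deleteEdges_adj.2 ⟨aux_rr.2 (by decide), hno _ _⟩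
      have a3 : ((attachTriangle G v).deleteEdges s).Adj (Sum.inr 1) (Sum.inl v) :=
        (deleteEdges_adj.2 ⟨aux_lr.2 rfl, hno _ _⟩ : Adj _ _ _).symm
      refine ha (Walk.cons a1 (Walk.cons a2 (Walk.cons a3 Walk.nil))) ?_
      simp [Walk.isCycle_def, Walk.isTrail_def]
    obtain ⟨e, hes, her⟩ := hex
    have h1 : (Sym2.map Sum.inl '' ((Sym2.map (Sum.inl : V → V ⊕ Fin 2)) ⁻¹' s)) ⊂ s := by
      refine ⟨Set.image_preimage_subset _ _, fun hsub => her ?_⟩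
      obtain ⟨e', -, h'⟩ := hsub hes
      exact ⟨e', h'⟩
    have h2 := Set.ncard_lt_ncard h1 (Set.toFinite _)
    rw [Set.ncard_image_of_injective _ hinj] at h2
    omega
  · let f : (G.deleteEdges ((Sym2.map Sum.inl) ⁻¹' s)) →g ((attachTriangle G v).deleteEdges s) :=
      ⟨Sum.inl, by
        intro a b hab
        rw [deleteEdges_adj] at hab ⊢
        exact ⟨aux_ll.2 hab.1, by simpa using hab.2⟩⟩
    exact ha.comap f Sum.inl_injective

theorem aux_hasv {V : Type*} {G : SimpleGraph V} {v : V} {S : Set (V ⊕ Fin 2)}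
    (hS : ((attachTriangle G v).induce S).Connected) {a : V} {i : Fin 2}
    (ha : Sum.inl a ∈ S) (hi : Sum.inr i ∈ S) : Sum.inl v ∈ S := by
  by_contra hv
  have := aux_reach (G := (attachTriangle G v).induce S) (H := (⊥ : SimpleGraph Bool))
    (fun x => x.1.isLeft) ?_ (hS.preconnected ⟨_, ha⟩ ⟨_, hi⟩)
  · rw [reachable_bot] at this
    simp at this
  · rintro ⟨x | x, hx⟩ ⟨y | y, hy⟩ hxy
    · exact Reachable.refl _
    · rw [comap_adj] at hxy
      have := aux_lr.1 hxy
      subst this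
      exact absurd hx hv
    · rw [comap_adj] at hxy
      have := aux_rl.1 hxy
      subst this
      exact absurd hy hv
    · exact Reachable.refl _

theorem aux_pre {V : Type*} {G : SimpleGraph V} {v : V} {S : Set (V ⊕ Fin 2)}
    (hS : ((attachTriangle G v).induce S).Connected) (hne : ∃ a, Sum.inl a ∈ S) :
    (G.induce (Sum.inl ⁻¹' S)).Connected := by
  obtain ⟨a, ha⟩ := hne
  let f : S → (Sum.inl ⁻¹' S : Set V) := fun x => match x with
    | ⟨Sum.inl b, hb⟩ => ⟨b, hb⟩
    | ⟨Sum.inr i, hi⟩ => ⟨v, aux_hasv hS ha hi⟩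
  rw [connected_iff_exists_forall_reachable]
  refine ⟨⟨a, ha⟩, ?_⟩
  rintro ⟨b, hb⟩
  refine aux_reach (G := (attachTriangle G v).induce S) f ?_ (hS.preconnected ⟨_, ha⟩ ⟨_, hb⟩)
  rintro ⟨x | x, hx⟩ ⟨y | y, hy⟩ hxy
  · exact Adj.reachable (by simpa [f, aux_ll] using hxy)
  · rw [comap_adj] at hxy
    have := aux_lr.1 hxy
    subst this
    exact Reachable.refl _
  · rw [comap_adj] at hxy
    have := aux_rl.1 hxy
    subst this
    exact Reachable.refl _
  · exact Reachable.refl _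

theorem aux_le_succ {V : Type*} [Finite V] {G : SimpleGraph V} {k : ℕ}
    (hmin : ∀ (W : Type) [Fintype W] (H : SimpleGraph W), IsProperMinor H G → fes H ≤ k)
    {W : Type} [Fintype W] {H : SimpleGraph W} (hH : IsMinor H G) : fes H ≤ k + 1 := by
  by_cases hE : H.edgeSet = ∅
  · rw [aux_fes_le]
    refine ⟨∅, by simp, ?_⟩
    rw [edgeSet_eq_empty] at hE
    subst hE
    simp
  · obtain ⟨e, he⟩ := Set.nonempty_iff_ne_empty.2 hE
    have h1 : fes (H.deleteEdges {e}) ≤ k := by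
      apply hmin
      refine ⟨?_, fun hcon => ?_⟩
      · obtain ⟨φ, a, b, c, d⟩ := hH
        exact ⟨φ, a, b, c, fun w w' h => d w w' (deleteEdges_le _ h)⟩
      · have h1 := aux_edges hcon
        have h2 := aux_edges hH
        have h3 : (H.deleteEdges {e}).edgeSet ⊂ H.edgeSet := by
          rw [edgeSet_deleteEdges]
          refine ⟨Set.sdiff_subset, fun h => ?_⟩
          exact (h he).2 rfl
        have := Set.ncard_lt_ncard h3 (Set.toFinite _)
        omega
    rw [aux_fes_le] at h1 ⊢
    obtain ⟨s, hs, ha⟩ := h1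
    refine ⟨insert e s, (Set.ncard_insert_le _ _).trans (by omega), ?_⟩
    rw [deleteEdges_deleteEdges] at ha
    exact ha

theorem aux_single {V : Type*} (G : SimpleGraph V) (a : V) :
    (G.induce {a}).Connected := by
  rw [connected_iff_exists_forall_reachable]
  refine ⟨⟨a, rfl⟩, ?_⟩
  rintro ⟨b, rfl⟩
  exact Reachable.refl _

/-- A minor model between graphs that are minors of each other is an isomorphism. -/
theorem aux_iso {V W : Type*} [Finite V] [Finite W] {G : SimpleGraph V} {H : SimpleGraph W}
    (φ : W → Set V) (hne : ∀ w, (φ w).Nonempty)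
    (hd : Pairwise fun w w' => Disjoint (φ w) (φ w'))
    (he : ∀ w w', H.Adj w w' → ∃ u ∈ φ w, ∃ v ∈ φ w', G.Adj u v)
    (hGH : IsMinor G H) : ∃ g : V → W, Function.Injective g ∧ (∀ a, a ∈ φ (g a)) ∧
      ∀ a b, G.Adj a b → H.Adj (g a) (g b) := by
  have hu : ∀ x a b, x ∈ φ a → x ∈ φ b → a = b := by
    intro x a b ha hb
    by_contra hab
    exact Set.disjoint_left.1 (hd hab) ha hb
  choose f hf using hne
  have hfi : Function.Injective f := fun a b hab => hu _ _ _ (hf a) (hab ▸ hf b)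
  have hcard : Nat.card V ≤ Nat.card W := by
    obtain ⟨ψ, hn, -, hd', -⟩ := hGH
    choose g hg using hn
    refine Nat.card_le_card_of_injective g fun a b hab => ?_
    by_contra hne
    exact Set.disjoint_left.1 (hd' hne) (hg a) (hab ▸ hg b)
  have hfb : Function.Bijective f :=
    (Nat.bijective_iff_injective_and_card f).2
      ⟨hfi, le_antisymm (Nat.card_le_card_of_injective f hfi) hcard⟩
  have hsing : ∀ w x, x ∈ φ w → x = f w := by
    intro w x hx
    obtain ⟨w', rfl⟩ := hfb.2 x
    rw [hu _ _ _ hx (hf w')]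
  have hle : H ≤ G.comap f := by
    intro a b hab
    obtain ⟨u, hu', v, hv', hadj⟩ := he a b hab
    rw [comap_adj, ← hsing _ _ hu', ← hsing _ _ hv']
    exact hadj
  have hmin : IsMinor (G.comap f) G := by
    refine ⟨fun w => {f w}, fun w => ⟨_, rfl⟩, fun w => ?_, fun a b hab => ?_, fun a b hab => ?_⟩
    · exact aux_single _ _
    · simpa using fun h => hab (hfi h)
    · exact ⟨_, rfl, _, rfl, hab⟩
  have heq : H.edgeSet = (G.comap f).edgeSet :=
    Set.eq_of_subset_of_ncard_le (edgeSet_mono hle)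
      ((aux_edges hmin).trans (aux_edges hGH)) (Set.toFinite _)
  rw [edgeSet_inj] at heq
  choose g hg using hfb.2
  refine ⟨g, fun a b hab => by rw [← hg a, ← hg b, hab], fun a => ?_, fun a b hab => ?_⟩
  · have := hf (g a)
    rwa [hg] at this
  · rw [heq, comap_adj, hg, hg]
    exact hab

end aux
/-- If a connected graph `G` is a minor-order obstruction for `k`-FES, then the graph
obtained from `G` by attaching a triangle at a vertex of `G` is a connected
obstruction for `(k+1)`-FES. -/
theorem stmt19 {V : Type*} [Fintype V] (G : SimpleGraph V) (k : ℕ) (v : V)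
    (hconn : G.Connected)
    (hG : ¬ fes G ≤ k)
    (hmin : ∀ (W : Type) [Fintype W] (H : SimpleGraph W),
      IsProperMinor H G → fes H ≤ k) :
    (attachTriangle G v).Connected ∧
    ¬ fes (attachTriangle G v) ≤ k + 1 ∧
    (∀ (W : Type) [Fintype W] (H : SimpleGraph W),
      IsProperMinor H (attachTriangle G v) → fes H ≤ k + 1) := by
  classical
  refine ⟨aux_conn hconn, fun h => hG (aux_low h), ?_⟩
  intro W _ H hH
  obtain ⟨⟨φ, hne, hc, hd, he⟩, hnot⟩ := hH
  have hu : ∀ x a b, x ∈ φ a → x ∈ φ b → a = b := by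
    intro x a b ha hb
    by_contra hab
    exact Set.disjoint_left.1 (hd hab) ha hb
  -- `A` is the set of branch vertices meeting `G`
  let A : Set W := {w | ∃ a, Sum.inl a ∈ φ w}
  have hlab : ∀ w, ∃ i : Fin 2, w ∉ A → Sum.inr i ∈ φ w := by
    intro w
    by_cases hw : w ∈ A
    · exact ⟨0, fun h => absurd hw h⟩
    · obtain ⟨x | i, hx⟩ := hne w
      · exact absurd ⟨x, hx⟩ hw
      · exact ⟨i, fun _ => hx⟩
  choose c hcφ using hlab
  have hci : ∀ x y, x ∉ A → y ∉ A → c x = c y → x = y := by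
    intro x y hx hy hxy
    exact hu _ _ _ (hcφ x hx) (hxy ▸ hcφ y hy)
  have hpig : ∀ x y z, x ∉ A → y ∉ A → z ∉ A → x ≠ y → x ≠ z → y = z := by
    intro x y z hx hy hz hxy hxz
    have h1 : c x ≠ c y := fun h => hxy (hci _ _ hx hy h)
    have h2 : c x ≠ c z := fun h => hxz (hci _ _ hx hz h)
    exact hci _ _ hy hz (by omega)
  -- edges from outside `A` into `A`
  have hout : ∀ x w, x ∉ A → w ∈ A → H.Adj x w → Sum.inl v ∈ φ w := by
    intro x w hx hw hadj
    obtain ⟨p, hp, q, hq, hpq⟩ := he _ _ hadj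
    rcases p with p | i
    · exact absurd ⟨p, hp⟩ hx
    rcases q with q | j
    · rw [aux_rl] at hpq
      exact hpq ▸ hq
    · obtain ⟨a, ha⟩ := hw
      exact aux_hasv (hc w) ha hq
  let H1 : SimpleGraph A := H.induce A
  let φ1 : A → Set V := fun w => Sum.inl ⁻¹' φ w.1
  have hne1 : ∀ w, (φ1 w).Nonempty := fun w => w.2
  have hd1 : Pairwise fun w w' => Disjoint (φ1 w) (φ1 w') := by
    intro a b hab
    exact (hd (fun h => hab (Subtype.ext h))).preimage _
  have he1 : ∀ w w', H1.Adj w w' → ∃ u ∈ φ1 w, ∃ v ∈ φ1 w', G.Adj u v := by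
    rintro ⟨w, a, ha⟩ ⟨w', b, hb⟩ hadj
    have hadj' : H.Adj w w' := hadj
    obtain ⟨p, hp, q, hq, hpq⟩ := he _ _ hadj'
    rcases p with p | i <;> rcases q with q | j
    · exact ⟨p, hp, q, hq, aux_ll.1 hpq⟩
    · rw [aux_lr] at hpq
      subst hpq
      exact absurd (hu _ _ _ hp (aux_hasv (hc w') hb hq)) hadj'.ne
    · rw [aux_rl] at hpq
      subst hpq
      exact absurd (hu _ _ _ (aux_hasv (hc w) ha hp) hq) hadj'.ne
    · exact absurd (hu _ _ _ (aux_hasv (hc w) ha hp) (aux_hasv (hc w') hb hq)) hadj'.ne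
  have hm1 : IsMinor H1 G := ⟨φ1, hne1, fun w => aux_pre (hc w.1) w.2, hd1, he1⟩
  -- local structure of a set of minimum degree two that leaves `A`
  have hstep : ∀ K : SimpleGraph W, K ≤ H → ∀ S : Set W,
      (∀ x ∈ S, ∃ y ∈ S, ∃ z ∈ S, y ≠ z ∧ K.Adj x y ∧ K.Adj x z) → ∀ x ∈ S, x ∉ A →
      ∃ x' w, x' ∈ S ∧ x' ∉ A ∧ w ∈ A ∧ Sum.inl v ∈ φ w ∧ K.Adj x x' ∧ K.Adj x w := by
    intro K hK S hS x hxS hxA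
    obtain ⟨y, hy, z, hz, hyz, hxy, hxz⟩ := hS x hxS
    by_cases hyA : y ∈ A <;> by_cases hzA : z ∈ A
    · exact absurd (hu _ _ _ (hout x y hxA hyA (hK hxy)) (hout x z hxA hzA (hK hxz))) hyz
    · exact ⟨z, y, hz, hzA, hyA, hout x y hxA hyA (hK hxy), hxz, hxy⟩
    · exact ⟨y, z, hy, hyA, hzA, hout x z hxA hzA (hK hxz), hxy, hxz⟩
    · exact absurd (hpig x y z hxA hyA hzA hxy.ne hxz.ne) hyz
  -- acyclicity on `A`
  have hacy : ∀ (s : Set (Sym2 A)) (t : Set (Sym2 W)), (H1.deleteEdges s).IsAcyclic →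
      ((H.deleteEdges (Sym2.map Subtype.val '' s ∪ t)).induce A).IsAcyclic := by
    intro s t hs
    refine hs.anti ?_
    intro a b hab
    rw [comap_adj, deleteEdges_adj] at hab
    rw [deleteEdges_adj]
    refine ⟨hab.1, fun h => hab.2 (Or.inl ⟨_, h, rfl⟩)⟩
  have hinj : Function.Injective (Sym2.map (Subtype.val : A → W)) :=
    Sym2.map.injective Subtype.val_injective
  by_cases hprop : IsMinor G H1
  · have hle := aux_le_succ hmin hm1
    rw [aux_fes_le] at hle ⊢
    obtain ⟨s, hs, ha⟩ := hle
    refine ⟨Sym2.map Subtype.val '' s ∪ ∅, ?_, aux_acyclic _ A (hacy s ∅ ha) ?_⟩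
    · rwa [Set.union_empty, Set.ncard_image_of_injective _ hinj]
    intro S hS x hxS
    by_contra hxA
    have hK := deleteEdges_le (G := H) (Sym2.map Subtype.val '' s ∪ ∅)
    obtain ⟨x', w, hx'S, hx'A, hwA, hvw, hxx', hxw⟩ := hstep _ hK S hS x hxS hxA
    obtain ⟨x'', w', -, hx''A, -, hvw', -, hxw'⟩ := hstep _ hK S hS x' hx'S hx'A
    obtain rfl := hu _ _ _ hvw hvw'
    obtain ⟨g, hgi, hgφ, hgadj⟩ := aux_iso φ1 hne1 hd1 he1 hprop
    have hgv : (g v).1 = w := hu _ _ _ (hgφ v) hvw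
    apply hnot
    let F : V ⊕ Fin 2 → W := fun p => match p with
      | Sum.inl a => (g a).1
      | Sum.inr i => if i = 0 then x else x'
    have hF0 : ∀ i, F (Sum.inr i) ∉ A := by
      intro i
      simp only [F]
      split_ifs <;> assumption
    have hFv : ∀ i, H.Adj (F (Sum.inl v)) (F (Sum.inr i)) := by
      intro i
      simp only [F, hgv]
      split_ifs
      · exact (hK hxw).symm
      · exact (hK hxw').symm
    have hFr : ∀ i j, i ≠ j → H.Adj (F (Sum.inr i)) (F (Sum.inr j)) := by
      intro i j hij
      simp only [F]
      split_ifs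
      · omega
      · exact hK hxx'
      · exact (hK hxx').symm
      · omega
    have hFi : ∀ p q, p ≠ q → F p ≠ F q := by
      rintro (a | i) (b | j) hpq heq
      · exact hpq (congrArg _ (hgi (Subtype.ext heq)))
      · exact hF0 j (heq ▸ (g a).2)
      · exact hF0 i (heq ▸ (g b).2)
      · exact (hFr i j (fun h => hpq (congrArg _ h))).ne heq
    refine ⟨fun p => {F p}, fun p => ⟨_, rfl⟩, fun p => aux_single _ _, fun p q hpq => ?_,
      fun p q hpq => ⟨_, rfl, _, rfl, ?_⟩⟩
    · simpa using hFi p q hpq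
    · rcases p with a | i <;> rcases q with b | j
      · exact hgadj _ _ (aux_ll.1 hpq)
      · rw [aux_lr] at hpq
        subst hpq
        exact hFv j
      · rw [aux_rl] at hpq
        subst hpq
        exact (hFv i).symm
      · exact hFr i j (aux_rr.1 hpq)
  · have hle := hmin A H1 ⟨hm1, hprop⟩
    rw [aux_fes_le] at hle ⊢
    obtain ⟨s, hs, ha⟩ := hle
    let t : Set (Sym2 W) := {e | ∃ x y, x ∉ A ∧ y ∉ A ∧ x ≠ y ∧ e = s(x, y)}
    have ht : t.ncard ≤ 1 := by
      rw [Set.ncard_le_one (Set.toFinite _)]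
      rintro _ ⟨x, y, hx, hy, hxy, rfl⟩ _ ⟨x', y', hx', hy', hxy', rfl⟩
      by_cases h : x = x'
      · subst h
        rw [hpig x y y' hx hy hy' hxy hxy']
      · obtain rfl := hpig x y x' hx hy hx' hxy h
        obtain rfl := hpig y x y' hy hx hy' hxy.symm hxy'
        exact Sym2.eq_swap
    refine ⟨Sym2.map Subtype.val '' s ∪ t, ?_, aux_acyclic _ A (hacy s t ha) ?_⟩
    · refine (Set.ncard_union_le _ _).trans ?_
      rw [Set.ncard_image_of_injective _ hinj]
      omega
    intro S hS x hxS
    by_contra hxA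
    obtain ⟨x', w, hx'S, hx'A, hwA, hvw, hxx', hxw⟩ :=
      hstep _ (deleteEdges_le _) S hS x hxS hxA
    rw [deleteEdges_adj] at hxx'
    exact hxx'.2 (Or.inr ⟨x, x', hxA, hx'A, hxx'.1.ne, rfl⟩)
end
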